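/- For all n ≥ 0 and 0 ≤ k ≤ n, the number of 312-avoiding permutations π ∈ S_{n+1} with π_{n+1} = n+1, no double descents, and exactly n-k ascents equals (1/(k+1))·binom(2k,k)·binom(n,2k). -/

import Mathlib

/-- `w` is (the word of) a permutation of `{1, …, n}`. -/
def IsPermWord (n : ℕ) (w : List ℕ) : Prop := w.Perm (List.range' 1 n)

/-- `w` is 312-avoiding: there are no positions `i < j < k` with `w_j < w_k < w_i`. -/
def Avoids312 (w : List ℕ) : Prop :=
  ¬ ∃ i j k : ℕ, i < j ∧ j < k ∧ k < w.length ∧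
      w.getD j 0 < w.getD k 0 ∧ w.getD k 0 < w.getD i 0

/-- `w` is 231-avoiding: there are no positions `i < j < k` with `w_k < w_i < w_j`. -/
def Avoids231 (w : List ℕ) : Prop :=
  ¬ ∃ i j k : ℕ, i < j ∧ j < k ∧ k < w.length ∧
      w.getD k 0 < w.getD i 0 ∧ w.getD i 0 < w.getD j 0

/-- `w` has a double descent: three consecutive strictly decreasing entries. -/
def HasDoubleDescent (w : List ℕ) : Prop :=
  ∃ i : ℕ, i + 2 < w.length ∧
    w.getD (i + 1) 0 < w.getD i 0 ∧ w.getD (i + 2) 0 < w.getD (i + 1) 0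

/-- The set of (0-indexed) ascents of a word. -/
def ascentSet (w : List ℕ) : Finset ℕ :=
  (Finset.range (w.length - 1)).filter fun i => w.getD i 0 < w.getD (i + 1) 0

/-- The set of (0-indexed) descents of a word. -/
def descentSet (w : List ℕ) : Finset ℕ :=
  (Finset.range (w.length - 1)).filter fun i => w.getD (i + 1) 0 < w.getD i 0

/-- The set of (0-indexed) peaks of a word: positions `1 ≤ i ≤ m - 2` (0-indexed)
with `w_{i-1} < w_i > w_{i+1}`. -/
def peakSet (w : List ℕ) : Finset ℕ :=
  (Finset.Icc 1 (w.length - 2)).filter fun i =>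
    w.getD (i - 1) 0 < w.getD i 0 ∧ w.getD (i + 1) 0 < w.getD i 0

/-- The reverse-complement map `r` on words of permutations in `S_{n+1}`:
`(r(π))_i = n + 2 - π_{n+2-i}` (1-indexed). -/
def rword (n : ℕ) (w : List ℕ) : List ℕ :=
  (List.range (n + 1)).map fun j => n + 2 - w.getD (n - j) 0

open Finset in
/-- A Vandermonde-type convolution of columns of Pascal's triangle. -/
theorem sum_antidiagonal_choose_mul_choose (m p q : ℕ) :
    ∑ x ∈ antidiagonal m, x.1.choose p * x.2.choose q = (m + 1).choose (p + q + 1) := by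
  induction q generalizing m with
  | zero =>
    simp only [Nat.choose_zero_right, mul_one, add_zero]
    rw [Finset.Nat.sum_antidiagonal_eq_sum_range_succ_mk]
    induction m with
    | zero => cases p <;> simp [Nat.choose_eq_zero_of_lt]
    | succ m ih => rw [sum_range_succ, ih, Nat.choose_succ_succ (m + 1), add_comm]
  | succ q ihq =>
    induction m with
    | zero => simp [Nat.choose_eq_zero_of_lt]
    | succ m ih =>
      rw [Finset.Nat.sum_antidiagonal_succ']
      simp only [Nat.choose_succ_succ _ q, mul_add, sum_add_distrib, Nat.choose_zero_succ, mul_zero,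
        zero_add]
      rw [ih, ihq, Nat.choose_succ_succ (m + 1) (p + (q + 1))]
      simp [add_assoc]

namespace List

/-- The number of ascents of a word. -/
def ascents : List ℕ → ℕ
  | x :: y :: l => (if x < y then 1 else 0) + ascents (y :: l)
  | _ => 0

/-- No three consecutive entries are strictly decreasing. -/
def NoDoubleDescent : List ℕ → Prop
  | x :: y :: z :: l => ¬ (y < x ∧ z < y) ∧ NoDoubleDescent (y :: z :: l)
  | _ => True

/-- Structural form of 312-avoidance. -/
def No312 : List ℕ → Prop
  | [] => True
  | x :: l => l.Pairwise (fun y z => ¬ (y < z ∧ z < x)) ∧ No312 l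

theorem ascents_add_one_le {l : List ℕ} (h : l ≠ []) : l.ascents + 1 ≤ l.length := by
  induction l using ascents.induct with
  | case1 x y l ih => have := ih (by simp); simp only [ascents, length_cons] at *; split <;> omega
  | case2 l hl => cases l <;> simp_all [ascents]

theorem card_ascentSet (w : List ℕ) : (ascentSet w).card = w.ascents := by
  have key (w : List ℕ) : (ascentSet w).card =
      ∑ i ∈ Finset.range (w.length - 1), if w.getD i 0 < w.getD (i + 1) 0 then 1 else 0 := by
    simp [ascentSet]
  induction w using ascents.induct with
  | case1 x y l ih =>
    rw [key] at ih ⊢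
    simp only [length_cons, Nat.add_sub_cancel] at ih ⊢
    rw [Finset.sum_range_succ', ascents, ← ih, add_comm]
    simp
  | case2 l hl =>
    match l with
    | [] => simp [ascentSet, ascents]
    | [x] => simp [ascentSet, ascents]
    | x :: y :: l => exact (hl x y l rfl).elim

theorem not_hasDoubleDescent_iff (w : List ℕ) : ¬ HasDoubleDescent w ↔ w.NoDoubleDescent := by
  induction w using NoDoubleDescent.induct with
  | case1 x y z l ih =>
    rw [NoDoubleDescent, ← ih, ← not_or, not_iff_not]
    constructor
    · rintro ⟨i, h1, h2⟩
      cases i with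
      | zero => left; simpa using h2
      | succ i => right; exact ⟨i, by simpa using h1, by simpa using h2⟩
    · rintro (h | ⟨i, h1, h2⟩)
      · exact ⟨0, by simp, by simpa using h⟩
      · exact ⟨i + 1, by simpa using h1, by simpa using h2⟩
  | case2 l hl =>
    match l with
    | [] => simp [HasDoubleDescent, NoDoubleDescent]
    | [x] => simp [HasDoubleDescent, NoDoubleDescent]
    | [x, y] => simp [HasDoubleDescent, NoDoubleDescent]
    | x :: y :: z :: l => exact (hl x y z l rfl).elim

theorem avoids312_iff (w : List ℕ) : Avoids312 w ↔ w.No312 := by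
  induction w with
  | nil => simp [Avoids312, No312]
  | cons x l ih =>
    rw [No312, ← ih, pairwise_iff_getElem]
    constructor
    · intro h
      refine ⟨fun j k hj hk hjk hlt => h ⟨0, j + 1, k + 1, by omega, by omega, by simpa, ?_⟩, ?_⟩
      · simpa [hj, hk] using hlt
      · rintro ⟨i, j, k, hij, hjk, hk, hlt⟩
        exact h ⟨i + 1, j + 1, k + 1, by omega, by omega, by simpa, by simpa using hlt⟩
    · rintro ⟨h1, h2⟩ ⟨i, j, k, hij, hjk, hk, hlt⟩
      obtain ⟨j, rfl⟩ : ∃ j', j = j' + 1 := ⟨j - 1, by omega⟩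
      obtain ⟨k, rfl⟩ : ∃ k', k = k' + 1 := ⟨k - 1, by omega⟩
      simp only [length_cons, Nat.add_lt_add_iff_right] at hjk hk
      cases i with
      | zero =>
        refine h1 j k (by omega) hk hjk ?_
        simpa [hk, hjk.trans hk] using hlt
      | succ i => exact h2 ⟨i, j, k, by omega, hjk, hk, by simpa using hlt⟩

theorem ascents_append_cons {A B : List ℕ} {s : ℕ} (hA : ∀ a ∈ A, s < a) (hB : ∀ b ∈ B, s < b)
    (hne : B ≠ []) : (A ++ s :: B).ascents = A.ascents + (B.ascents + 1) := by
  induction A using ascents.induct with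
  | case1 x y l ih =>
    have := ih (by simp_all)
    simp only [cons_append, ascents] at *
    omega
  | case2 l hl =>
    match l, B with
    | [], b :: B => simp_all [ascents, add_comm]
    | [x], b :: B =>
      have : ¬ x < s := by simp at hA; omega
      simp_all [ascents, add_comm]
    | x :: y :: l, _ => exact (hl x y l rfl).elim

theorem noDoubleDescent_append_cons {A B : List ℕ} {s : ℕ} (hB : ∀ b ∈ B, s < b) :
    (A ++ s :: B).NoDoubleDescent ↔ (A ++ [s]).NoDoubleDescent ∧ B.NoDoubleDescent := by
  induction A using NoDoubleDescent.induct with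
  | case1 x y z l ih =>
    simp only [cons_append, NoDoubleDescent] at *
    rw [ih, and_assoc]
  | case2 l hl =>
    have h0 : (s :: B).NoDoubleDescent ↔ B.NoDoubleDescent := by
      match B with
      | [] => simp [NoDoubleDescent]
      | [x] => simp [NoDoubleDescent]
      | x :: y :: B =>
        have := hB x (by simp)
        simp [NoDoubleDescent, this.le]
    have h1 (x : ℕ) : (x :: s :: B).NoDoubleDescent ↔ B.NoDoubleDescent := by
      rw [← h0]
      match B with
      | [] => simp [NoDoubleDescent]
      | b :: B =>
        have := hB b (by simp)
        simp [NoDoubleDescent, this.le]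
    match l with
    | [] => simp [h0, NoDoubleDescent]
    | [x] => simp [h1, NoDoubleDescent]
    | [x, y] => simp [NoDoubleDescent, h1]
    | x :: y :: z :: l => exact (hl x y z l rfl).elim

theorem noDoubleDescent_concat_concat {A : List ℕ} {m s : ℕ} (hA : ∀ a ∈ A, a < m) :
    (A ++ [m, s]).NoDoubleDescent ↔ (A ++ [m]).NoDoubleDescent := by
  induction A using NoDoubleDescent.induct with
  | case1 x y z l ih =>
    have := ih (by simp_all)
    simp only [cons_append, NoDoubleDescent] at *
    rw [this]
  | case2 l hl =>
    match l with
    | [] => simp [NoDoubleDescent]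
    | [x] =>
      have := hA x (by simp)
      simp [NoDoubleDescent, this.le]
    | [x, y] =>
      have := hA y (by simp)
      simp [NoDoubleDescent, this.le]
    | x :: y :: z :: l => exact (hl x y z l rfl).elim

theorem NoDoubleDescent.of_append_right {A B : List ℕ} (h : (A ++ B).NoDoubleDescent) :
    B.NoDoubleDescent := by
  induction A with
  | nil => exact h
  | cons x A ih =>
    apply ih
    rw [cons_append] at h
    generalize A ++ B = l at h
    match l with
    | [] => trivial
    | [y] => trivial
    | y :: z :: l => exact h.2

theorem no312_append_cons {A B : List ℕ} {s : ℕ} (hA : ∀ a ∈ A, s < a) (hB : ∀ b ∈ B, s < b) :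
    (A ++ s :: B).No312 ↔ A.No312 ∧ B.No312 ∧ ∀ a ∈ A, ∀ b ∈ B, a ≤ b := by
  induction A with
  | nil =>
    simp only [nil_append, No312, true_and, not_mem_nil, false_imp_iff, implies_true, and_true,
      and_iff_right_iff_imp]
    refine fun _ => pairwise_of_forall_mem_list fun a _ b hb => ?_
    have := hB b hb
    omega
  | cons a A ih =>
    rw [cons_append, No312, ih (by simp_all), No312, pairwise_append, pairwise_cons]
    have hs := hA a (by simp)
    constructor
    · rintro ⟨⟨h1, ⟨h2, h3⟩, h4⟩, h5, h6, h7⟩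
      refine ⟨⟨h1, h5⟩, h6, ?_⟩
      simp only [mem_cons, forall_eq_or_imp]
      refine ⟨fun b hb => ?_, h7⟩
      have := h2 b hb
      have := hB b hb
      omega
    · rintro ⟨⟨h1, h5⟩, h6, h7⟩
      have h8 : ∀ b ∈ B, a ≤ b := h7 a (by simp)
      refine ⟨⟨h1, ⟨fun b hb => ?_, ?_⟩, ?_⟩, h5, h6, fun x hx => h7 x (by simp [hx])⟩
      · have := h8 b hb
        omega
      · refine pairwise_of_forall_mem_list fun x _ y hy => ?_
        have := h8 y hy
        omega
      · intro x hx y hy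
        have := hA x (by simp [hx])
        simp only [mem_cons] at hy
        rcases hy with rfl | hy
        · omega
        · have := h8 y hy
          omega

/-- A 312-avoiding word whose last step is an ascent ends in its maximum. -/
theorem No312.le_of_lt {A : List ℕ} {y m : ℕ} (h : (A ++ [y, m]).No312) (hlt : y < m) :
    ∀ a ∈ A, a ≤ m := by
  induction A with
  | nil => simp
  | cons x A ih =>
    rw [cons_append, No312, pairwise_append] at h
    simp only [mem_cons, forall_eq_or_imp]
    refine ⟨?_, ih h.2⟩
    have := h.1.2.1
    simp at this
    omega

theorem No312.lt_of_noDoubleDescent {A : List ℕ} {m s : ℕ} (h : (A ++ [m]).No312)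
    (hnd : (A ++ [m]).Nodup) (hs : s < m) (hdd : (A ++ [m, s]).NoDoubleDescent) :
    ∀ a ∈ A, a < m := by
  rcases eq_nil_or_concat' A with rfl | ⟨A, y, rfl⟩
  · simp
  · simp only [append_assoc, cons_append, nil_append] at *
    have hy : y < m := by
      have := hdd.of_append_right.1
      have : y ≠ m := by
        rintro rfl
        have := (nodup_append.1 hnd).2.1
        simp at this
      omega
    intro a ha
    simp only [mem_append, mem_singleton] at ha
    rcases ha with ha | rfl
    · refine lt_of_le_of_ne (h.le_of_lt hy a ha) ?_
      exact (nodup_append.1 hnd).2.2 a ha m (by simp)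
    · exact hy

/-- If every entry of `A` is below every entry of `B` and together they form an interval, then each
of them forms an interval. -/
theorem perm_range'_of_append {A B : List ℕ} {s n : ℕ} (h : (A ++ B).Perm (range' s n))
    (hlt : ∀ a ∈ A, ∀ b ∈ B, a ≤ b) :
    A.Perm (range' s A.length) ∧ B.Perm (range' (s + A.length) B.length) := by
  have hn : A.length + B.length = n := by simpa using h.length_eq
  have hsort : A.mergeSort ++ B.mergeSort = range' s A.length ++ range' (s + A.length) B.length := by
    have e : range' s A.length ++ range' (s + A.length) B.length = range' s n := by
      rw [range'_append_1, hn]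
    rw [e]
    refine Perm.eq_of_pairwise (le := (· ≤ ·)) (fun a b _ _ => le_antisymm) ?_ ?_ ?_
    · rw [pairwise_append]
      refine ⟨by simpa using pairwise_mergeSort' (· ≤ ·) A,
        by simpa using pairwise_mergeSort' (· ≤ ·) B, ?_⟩
      simpa using hlt
    · exact (pairwise_lt_range' (s := s) (n := n)).imp le_of_lt
    · exact ((mergeSort_perm _ _).append (mergeSort_perm _ _)).trans h
  obtain ⟨h1, h2⟩ := append_inj hsort (by simp)
  exact ⟨h1 ▸ (mergeSort_perm _ _).symm, h2 ▸ (mergeSort_perm _ _).symm⟩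

end List

open List Finset

open Classical in
/-- The 312-avoiding arrangements of `s, …, s + n` that end in their maximum, have no double
descents, and have `n - k` ascents. -/
noncomputable def maxEndingWords (s n k : ℕ) : Finset (List ℕ) :=
  {w ∈ (range' s (n + 1)).permutations.toFinset |
    w.No312 ∧ w.getLast? = some (s + n) ∧ w.NoDoubleDescent ∧ w.ascents + k = n}

open Classical in
/-- The 312-avoiding arrangements of `s + 1, …, s + n` with `n - k` ascents that have no double
descents even after appending `s`. -/
noncomputable def extendableWords (s n k : ℕ) : Finset (List ℕ) :=
  {w ∈ (range' (s + 1) n).permutations.toFinset |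
    w.No312 ∧ (w ++ [s]).NoDoubleDescent ∧ w.ascents + k = n}

theorem mem_maxEndingWords {s n k : ℕ} {w : List ℕ} : w ∈ maxEndingWords s n k ↔
    w.Perm (range' s (n + 1)) ∧ w.No312 ∧ w.getLast? = some (s + n) ∧ w.NoDoubleDescent ∧
      w.ascents + k = n := by
  simp [maxEndingWords]

theorem mem_extendableWords {s n k : ℕ} {w : List ℕ} : w ∈ extendableWords s n k ↔
    w.Perm (range' (s + 1) n) ∧ w.No312 ∧ (w ++ [s]).NoDoubleDescent ∧ w.ascents + k = n := by
  simp [extendableWords]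

theorem extendableWords_succ_succ (s n k : ℕ) :
    extendableWords s (n + 1) (k + 1) = maxEndingWords (s + 1) n k := by
  ext w
  rw [mem_extendableWords, mem_maxEndingWords]
  refine and_congr_right fun hp => and_congr_right fun h312 => ?_
  rw [← and_assoc, ← add_assoc, Nat.add_right_cancel_iff]
  refine and_congr_left fun _ => ?_
  have hmem : ∀ x, x ∈ w ↔ s + 1 ≤ x ∧ x < s + 1 + (n + 1) := fun x => by
    rw [hp.mem_iff, mem_range'_1]
  have hnd : w.Nodup := hp.nodup_iff.2 nodup_range'
  rcases eq_nil_or_concat' w with rfl | ⟨A, m, rfl⟩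
  · simpa using hp.length_eq
  have hm := (hmem m).1 (by simp)
  rw [append_assoc, getLast?_append]
  simp only [cons_append, nil_append, getLast?_singleton, Option.some_or, Option.some.injEq]
  constructor
  · intro h
    have hlt := h312.lt_of_noDoubleDescent hnd (by omega) h
    refine ⟨?_, (noDoubleDescent_concat_concat hlt).1 h⟩
    have hmax := (hmem (s + 1 + n)).2 (by omega)
    simp only [mem_append, List.mem_singleton] at hmax
    rcases hmax with hmax | hmax
    · have := hlt _ hmax
      omega
    · exact hmax.symm
  · rintro ⟨rfl, h⟩
    refine (noDoubleDescent_concat_concat fun a ha => ?_).2 h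
    have := (hmem a).1 (by simp [ha])
    have := (nodup_append.1 hnd).2.2 a ha (s + 1 + n) (by simp)
    omega

theorem card_extendableWords_zero_zero (s : ℕ) : (extendableWords s 0 0).card = 1 := by
  rw [Finset.card_eq_one]
  refine ⟨[], ?_⟩
  ext w
  rw [mem_extendableWords, Finset.mem_singleton]
  constructor
  · rintro ⟨h, -⟩
    simpa using h
  · rintro rfl
    simp [No312, NoDoubleDescent, ascents]

theorem card_extendableWords_zero_succ (s k : ℕ) : (extendableWords s 0 (k + 1)).card = 0 := by
  rw [Finset.card_eq_zero, Finset.eq_empty_iff_forall_notMem]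
  intro w hw
  have := (mem_extendableWords.1 hw).2.2.2
  omega

theorem card_extendableWords_succ_zero (s n : ℕ) : (extendableWords s (n + 1) 0).card = 0 := by
  rw [Finset.card_eq_zero, Finset.eq_empty_iff_forall_notMem]
  intro w hw
  obtain ⟨hp, -, -, h⟩ := mem_extendableWords.1 hw
  have hl : w.length = n + 1 := by simpa using hp.length_eq
  have := ascents_add_one_le (l := w) (by rintro rfl; simp at hl)
  omega

open Classical in
/-- Splitting a word at its minimum. -/
theorem maxEndingWords_succ (s n k : ℕ) : maxEndingWords s (n + 1) k =
    (antidiagonal n ×ˢ antidiagonal k).biUnion fun p =>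
      (extendableWords s p.1.1 p.2.1 ×ˢ maxEndingWords (s + 1 + p.1.1) p.1.2 p.2.2).image
        fun q => q.1 ++ s :: q.2 := by
  ext w
  simp only [Finset.mem_biUnion, Finset.mem_product, HasAntidiagonal.mem_antidiagonal,
    Finset.mem_image, Prod.exists]
  constructor
  · intro hw
    obtain ⟨hp, h312, hlast, hdd, hasc⟩ := mem_maxEndingWords.1 hw
    obtain ⟨A, B, rfl⟩ := append_of_mem (hp.mem_iff.2 (by simp : s ∈ range' s (n + 1 + 1)))
    have hp' : (A ++ B).Perm (range' (s + 1) (n + 1)) := by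
      rw [range'_succ] at hp
      exact (perm_middle.symm.trans hp).cons_inv
    have hgt : ∀ x ∈ A ++ B, s < x := fun x hx => by
      have := hp'.mem_iff.1 hx
      rw [mem_range'_1] at this
      omega
    have hA : ∀ x ∈ A, s < x := fun x hx => hgt x (by simp [hx])
    have hB : ∀ x ∈ B, s < x := fun x hx => hgt x (by simp [hx])
    have hne : B ≠ [] := by
      rintro rfl
      simp at hlast
    have hBpos := length_pos_of_ne_nil hne
    obtain ⟨hA3, hB3, hle⟩ := (no312_append_cons hA hB).1 h312
    obtain ⟨hAd, hBd⟩ := (noDoubleDescent_append_cons hB).1 hdd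
    obtain ⟨hAp, hBp⟩ := perm_range'_of_append hp' hle
    rw [ascents_append_cons hA hB hne] at hasc
    have hlen : A.length + B.length = n + 1 := by simpa using hp'.length_eq
    have hBa := ascents_add_one_le hne
    have hAa : A.ascents ≤ A.length := by
      rcases eq_or_ne A [] with rfl | h
      · simp [ascents]
      · have := ascents_add_one_le h
        omega
    refine ⟨A.length, B.length - 1, A.length - A.ascents, B.length - 1 - B.ascents,
      ⟨by omega, by omega⟩, A, B, ⟨mem_extendableWords.2 ⟨hAp, hA3, hAd, by omega⟩,
      mem_maxEndingWords.2 ⟨?_, hB3, ?_, hBd, by omega⟩⟩, rfl⟩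
    · rwa [Nat.sub_add_cancel hBpos]
    · rw [getLast?_append, getLast?_cons] at hlast
      rw [getLast?_eq_some_getLast hne] at hlast ⊢
      simp at hlast ⊢
      omega
  · rintro ⟨i, j, a, b, ⟨hij, hab⟩, A, B, ⟨hA, hB⟩, rfl⟩
    obtain ⟨hAp, hA3, hAd, hAa⟩ := mem_extendableWords.1 hA
    obtain ⟨hBp, hB3, hBl, hBd, hBa⟩ := mem_maxEndingWords.1 hB
    have hAm : ∀ x ∈ A, s + 1 ≤ x ∧ x < s + 1 + i := fun x hx => by
      rwa [hAp.mem_iff, mem_range'_1] at hx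
    have hBm : ∀ x ∈ B, s + 1 + i ≤ x := fun x hx => by
      rw [hBp.mem_iff, mem_range'_1] at hx
      exact hx.1
    have hgA : ∀ x ∈ A, s < x := fun x hx => (hAm x hx).1
    have hgB : ∀ x ∈ B, s < x := fun x hx => by
      have := hBm x hx
      omega
    have hne : B ≠ [] := by
      rintro rfl
      simp at hBl
    refine mem_maxEndingWords.2 ⟨?_, (no312_append_cons hgA hgB).2 ⟨hA3, hB3, fun x hx y hy => ?_⟩,
      ?_, (noDoubleDescent_append_cons hgB).2 ⟨hAd, hBd⟩, ?_⟩
    · refine perm_middle.trans ?_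
      rw [range'_succ]
      refine ((hAp.append hBp).trans ?_).cons s
      rw [range'_append_1, ← hij, add_assoc]
    · have := hBm y hy
      have := (hAm x hx).2
      omega
    · rw [getLast?_append, getLast?_cons, hBl]
      simp
      omega
    · rw [ascents_append_cons hgA hgB hne]
      omega

theorem card_maxEndingWords_succ (s n k : ℕ) : (maxEndingWords s (n + 1) k).card =
    ∑ x ∈ antidiagonal n, ∑ y ∈ antidiagonal k,
      (extendableWords s x.1 y.1).card * (maxEndingWords (s + 1 + x.1) x.2 y.2).card := by
  classical
  have hs {i a : ℕ} {A : List ℕ} (hA : A ∈ extendableWords s i a) : s ∉ A := by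
    rw [(mem_extendableWords.1 hA).1.mem_iff, mem_range'_1]
    omega
  have hinj {i a i' a' : ℕ} {A A' B B' : List ℕ} (hA : A ∈ extendableWords s i a)
      (hA' : A' ∈ extendableWords s i' a') (h : A ++ s :: B = A' ++ s :: B') :
      A = A' ∧ B = B' := by
    have h1 := hs hA
    have h2 := hs hA'
    simp only [append_eq_append_iff, cons_eq_append_iff, cons_eq_cons] at h
    rcases h with (⟨c, rfl, ⟨rfl, h, rfl⟩ | ⟨d, rfl, h⟩⟩ |
      ⟨c, rfl, ⟨rfl, h, rfl⟩ | ⟨d, rfl, h⟩⟩) <;> simp_all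
  rw [maxEndingWords_succ, Finset.card_biUnion, Finset.sum_product]
  · refine Finset.sum_congr rfl fun x _ => Finset.sum_congr rfl fun y _ => ?_
    rw [Finset.card_image_of_injOn, Finset.card_product]
    rintro ⟨A, B⟩ h ⟨A', B'⟩ h' he
    simp only [Finset.coe_product, Set.mem_prod, Finset.mem_coe] at h h'
    obtain ⟨rfl, rfl⟩ := hinj h.1 h'.1 he
    rfl
  · rintro ⟨⟨i, j⟩, ⟨a, b⟩⟩ hx ⟨⟨i', j'⟩, ⟨a', b'⟩⟩ hy hne
    refine Finset.disjoint_left.2 fun w hw hw' => hne ?_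
    simp only [Finset.mem_image, Finset.mem_product, Prod.exists] at hw hw'
    simp only [Finset.coe_product, Set.mem_prod, Finset.mem_coe,
      HasAntidiagonal.mem_antidiagonal] at hx hy
    obtain ⟨A, B, ⟨hA, -⟩, rfl⟩ := hw
    obtain ⟨A', B', ⟨hA', -⟩, he⟩ := hw'
    obtain ⟨rfl, rfl⟩ := hinj hA' hA he
    obtain ⟨hp, -, -, ha⟩ := mem_extendableWords.1 hA
    obtain ⟨hp', -, -, ha'⟩ := mem_extendableWords.1 hA'
    have h1 : A'.length = i := by simpa using hp.length_eq
    have h2 : A'.length = i' := by simpa using hp'.length_eq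
    simp only [Prod.mk.injEq]
    omega

theorem card_maxEndingWords (s n k : ℕ) :
    (maxEndingWords s n k).card = catalan k * n.choose (2 * k) := by
  induction n using Nat.strong_induction_on generalizing s k with
  | _ n ih =>
  match n with
  | 0 =>
    cases k with
    | zero =>
      have : maxEndingWords s 0 0 = {[s]} := by
        ext w
        rw [mem_maxEndingWords, Finset.mem_singleton]
        constructor
        · rintro ⟨h, -⟩
          simpa using h
        · rintro rfl
          simp [No312, NoDoubleDescent, ascents]
      simp [this]
    | succ k =>
      have : maxEndingWords s 0 (k + 1) = ∅ := by
        rw [Finset.eq_empty_iff_forall_notMem]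
        intro w hw
        have := (mem_maxEndingWords.1 hw).2.2.2.2
        omega
      simp [this, mul_add]
  | n + 1 =>
    have hE (i a : ℕ) (hi : i < n) :
        (extendableWords s (i + 1) (a + 1)).card = catalan a * i.choose (2 * a) := by
      rw [extendableWords_succ_succ, ih i (by omega)]
    have hfirst (k : ℕ) : ∑ y ∈ antidiagonal k, (extendableWords s 0 y.1).card *
        (maxEndingWords (s + 1 + 0) n y.2).card = catalan k * n.choose (2 * k) := by
      cases k with
      | zero => simp [card_extendableWords_zero_zero, ih n]
      | succ k =>
        rw [Finset.Nat.sum_antidiagonal_succ]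
        simp [card_extendableWords_zero_zero, card_extendableWords_zero_succ, ih n]
    rw [card_maxEndingWords_succ]
    cases n with
    | zero =>
      simp only [Finset.Nat.antidiagonal_zero, Finset.sum_singleton]
      rw [hfirst]
      cases k with
      | zero => simp
      | succ k => simp [mul_add, Nat.choose_eq_zero_of_lt]
    | succ m =>
      rw [Finset.Nat.sum_antidiagonal_succ, hfirst]
      cases k with
      | zero => simp [card_extendableWords_succ_zero]
      | succ k =>
        have hrest : ∑ x ∈ antidiagonal m, ∑ y ∈ antidiagonal (k + 1),
            (extendableWords s (x.1 + 1) y.1).card *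
              (maxEndingWords (s + 1 + (x.1 + 1)) x.2 y.2).card =
            catalan (k + 1) * (m + 1).choose (2 * k + 1) := by
          rw [catalan_succ', Finset.sum_mul, Finset.sum_comm,
            Finset.Nat.sum_antidiagonal_succ (n := k)]
          simp only [card_extendableWords_succ_zero, zero_mul, Finset.sum_const_zero, zero_add]
          refine Finset.sum_congr rfl fun y hy => ?_
          have hk : 2 * k + 1 = 2 * y.1 + 2 * y.2 + 1 := by
            rw [HasAntidiagonal.mem_antidiagonal] at hy
            omega
          rw [hk, ← sum_antidiagonal_choose_mul_choose, Finset.mul_sum]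
          refine Finset.sum_congr rfl fun x hx => ?_
          rw [HasAntidiagonal.mem_antidiagonal] at hx
          rw [hE _ _ (by omega), ih _ (by omega)]
          ring
        rw [hrest, mul_add_one, Nat.choose_succ_succ (m + 1) (2 * k + 1)]
        ring

/-- **Theorem (Statement 15).** For `0 ≤ k ≤ n`, the number of 312-avoiding
permutations in `S_{n+1}` ending in `n+1`, with no double descents and exactly
`n - k` ascents, equals `(1/(k+1))·C(2k,k)·C(n,2k)` (stated multiplied through by
`k + 1`). -/
theorem card_pop_image_by_ascents (n k : ℕ) (hk : k ≤ n) :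
    (k + 1) *
        Set.ncard {w : List ℕ | IsPermWord (n + 1) w ∧ Avoids312 w ∧
          w.getD n 0 = n + 1 ∧ ¬ HasDoubleDescent w ∧ (ascentSet w).card = n - k} =
      Nat.choose (2 * k) k * Nat.choose n (2 * k) := by
  have hset : {w : List ℕ | IsPermWord (n + 1) w ∧ Avoids312 w ∧
      w.getD n 0 = n + 1 ∧ ¬ HasDoubleDescent w ∧ (ascentSet w).card = n - k} =
      maxEndingWords 1 n k := by
    ext w
    rw [Set.mem_ofPred_eq, Finset.mem_coe, mem_maxEndingWords, avoids312_iff,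
      not_hasDoubleDescent_iff, card_ascentSet, IsPermWord]
    refine and_congr_right fun hp => and_congr_right fun _ => ?_
    have hl : w.length = n + 1 := by simpa using hp.length_eq
    have hlast : w.getD n 0 = n + 1 ↔ w.getLast? = some (1 + n) := by
      simp [getLast?_eq_getElem?, hl, add_comm]
    have hasc : w.ascents = n - k ↔ w.ascents + k = n := by omega
    rw [hlast, hasc]
  rw [hset, Set.ncard_coe_finset, card_maxEndingWords, ← mul_assoc, succ_mul_catalan_eq_centralBinom,
    Nat.centralBinom]
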